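/- Assume Σ_{x∈ℤ}⟨x⟩(|α(x)−α₀| + |θ(x)|) < ∞ and let ξ ∈ {0, π}. Let φ₊(·,ξ), φ₋(·,ξ) be Jost solutions (which exist under this assumption). Then W_ξ := det(φ₊(x,ξ) | φ₋(x,ξ)) = 0 if and only if there exists a nonzero bounded solution v : ℤ → ℂ² of v(x+1) = T_{λ(ξ)}(x)·v(x) for all x ∈ ℤ. -/

import Mathlib

open Complex Matrix

noncomputable section

/-- The coin matrix `C_{α,β,θ} = e^{iθ}[[β, conj α],[−α, conj β]]`. -/
def coinMat (a b : ℂ) (t : ℝ) : Matrix (Fin 2) (Fin 2) ℂ :=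
  Complex.exp ((t : ℂ) * Complex.I) • !![b, (starRingEnd ℂ) a; -a, (starRingEnd ℂ) b]

/-- The quantum walk evolution operator `U = SĈ`, acting on arbitrary `u : ℤ → ℂ²`:
`(Uu)↑(x) = (C(x−1)u(x−1))↑`, `(Uu)↓(x) = (C(x+1)u(x+1))↓`. -/
def qw (C : ℤ → Matrix (Fin 2) (Fin 2) ℂ) (u : ℤ → Fin 2 → ℂ) : ℤ → Fin 2 → ℂ :=
  fun x => ![(C (x - 1)).mulVec (u (x - 1)) 0, (C (x + 1)).mulVec (u (x + 1)) 1]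

/-- `ρ = √(1−|a|²)`. -/
def rho (a : ℂ) : ℝ := Real.sqrt (1 - ‖a‖ ^ 2)

/-- The coin map `x ↦ C_{α(x), ρ(x), θ(x)}`. -/
def coinOf (α : ℤ → ℂ) (θ : ℤ → ℝ) : ℤ → Matrix (Fin 2) (Fin 2) ℂ :=
  fun x => coinMat (α x) ((rho (α x) : ℝ) : ℂ) (θ x)

/-- The transfer matrix `T_λ(x)`. -/
def Tmat (α : ℤ → ℂ) (θ : ℤ → ℝ) (lam : ℂ) (x : ℤ) : Matrix (Fin 2) (Fin 2) ℂ :=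
  (((rho (α x) : ℝ) : ℂ))⁻¹ •
    !![Complex.exp (Complex.I * (lam - (θ x : ℂ))), α x;
       (starRingEnd ℂ) (α x), Complex.exp (-(Complex.I * (lam - (θ x : ℂ))))]

/-- `(J_VE u)(x) = (u↓(x−1), u↑(x))`. -/
def Jve (u : ℤ → Fin 2 → ℂ) : ℤ → Fin 2 → ℂ := fun x => ![u (x - 1) 1, u x 0]

/-- `(J_EV v)(x) = (v↓(x), v↑(x+1))`, the inverse of `J_VE`. -/
def Jev (v : ℤ → Fin 2 → ℂ) : ℤ → Fin 2 → ℂ := fun x => ![v x 1, v (x + 1) 0]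

/-- Determinant of the 2×2 matrix with columns `v, w`. -/
def det2 (v w : Fin 2 → ℂ) : ℂ := v 0 * w 1 - v 1 * w 0

/-- The Euclidean norm on ℂ². -/
def nrm2 (v : Fin 2 → ℂ) : ℝ := Real.sqrt (‖v 0‖ ^ 2 + ‖v 1‖ ^ 2)

/-- Membership in `l²(ℤ, ℂ²)`. -/
def MemL2 (u : ℤ → Fin 2 → ℂ) : Prop := Summable fun x : ℤ => ‖u x 0‖ ^ 2 + ‖u x 1‖ ^ 2

/-- The Japanese bracket `⟨x⟩ = √(1+x²)`. -/
def jp (x : ℤ) : ℝ := Real.sqrt (1 + (x : ℝ) ^ 2)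

/-- The free transfer matrix `T_{0,λ}` (for real `λ`). -/
def T0m (a0 : ℂ) (lam : ℝ) : Matrix (Fin 2) (Fin 2) ℂ :=
  (((rho a0 : ℝ) : ℂ))⁻¹ •
    !![Complex.exp (Complex.I * (lam : ℂ)), a0;
       (starRingEnd ℂ) a0, Complex.exp (-(Complex.I * (lam : ℂ)))]

/-- `λ(ξ) = arccos(ρ₀ cos ξ) ∈ [0,π]`. -/
def lamOf (a0 : ℂ) (ξ : ℝ) : ℝ := Real.arccos (rho a0 * Real.cos ξ)

/-- `A_{ξ,±} = e^{∓iξ}T_{0,λ(ξ)}`; `ε = 1` is the `+` case, `ε = −1` the `−` case. -/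
def Amat (a0 : ℂ) (ε : ℝ) (ξ : ℝ) : Matrix (Fin 2) (Fin 2) ℂ :=
  Complex.exp (-(((ε * ξ : ℝ) : ℂ) * Complex.I)) • T0m a0 (lamOf a0 ξ)

/-- Integer powers of a matrix: for negative exponents, powers of the inverse matrix. -/
def mzpow (A : Matrix (Fin 2) (Fin 2) ℂ) (x : ℤ) : Matrix (Fin 2) (Fin 2) ℂ :=
  if 0 ≤ x then A ^ x.toNat else A⁻¹ ^ (-x).toNat

/-- The operator norm on `ℂ²` of a 2×2 matrix. -/
def opN (A : Matrix (Fin 2) (Fin 2) ℂ) : ℝ := ‖Matrix.toEuclideanCLM (𝕜 := ℂ) A‖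

/-- `A_±(ξ) = |α₀|² + |e^{iλ(ξ)} − ρ₀e^{±iξ}|²`; `ε = ±1`. -/
def Aco (a0 : ℂ) (ε : ℝ) (ξ : ℝ) : ℝ :=
  ‖a0‖ ^ 2 + ‖Complex.exp (Complex.I * (lamOf a0 ξ : ℂ))
      - ((rho a0 : ℝ) : ℂ) * Complex.exp (((ε * ξ : ℝ) : ℂ) * Complex.I)‖ ^ 2

/-- The unit eigenvector `φ_±(ξ) = A_±(ξ)^{−1/2}(−α₀, e^{iλ(ξ)} − ρ₀e^{±iξ})ᵀ`; `ε = ±1`. -/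
def jvec (a0 : ℂ) (ε : ℝ) (ξ : ℝ) : Fin 2 → ℂ :=
  (((Real.sqrt (Aco a0 ε ξ))⁻¹ : ℝ) : ℂ) •
    ![-a0, Complex.exp (Complex.I * (lamOf a0 ξ : ℂ))
        - ((rho a0 : ℝ) : ℂ) * Complex.exp (((ε * ξ : ℝ) : ℂ) * Complex.I)]

/-- `φ` is a Jost solution `φ₊(·,ξ)`: solves the transfer recursion at `λ(ξ)` and
`e^{−iξx}φ(x) → φ₊(ξ)` as `x → +∞`. -/
def IsJostP (α : ℤ → ℂ) (θ : ℤ → ℝ) (a0 : ℂ) (ξ : ℝ) (φ : ℤ → Fin 2 → ℂ) : Prop :=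
  (∀ x : ℤ, φ (x + 1) = (Tmat α θ ((lamOf a0 ξ : ℝ) : ℂ) x).mulVec (φ x)) ∧
  Filter.Tendsto
    (fun x : ℤ => fun i : Fin 2 => Complex.exp (-(((ξ * x : ℝ) : ℂ) * Complex.I)) * φ x i)
    Filter.atTop (nhds (jvec a0 1 ξ))

/-- `φ` is a Jost solution `φ₋(·,ξ)`: solves the transfer recursion at `λ(ξ)` and
`e^{iξx}φ(x) → φ₋(ξ)` as `x → −∞`. -/
def IsJostM (α : ℤ → ℂ) (θ : ℤ → ℝ) (a0 : ℂ) (ξ : ℝ) (φ : ℤ → Fin 2 → ℂ) : Prop :=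
  (∀ x : ℤ, φ (x + 1) = (Tmat α θ ((lamOf a0 ξ : ℝ) : ℂ) x).mulVec (φ x)) ∧
  Filter.Tendsto
    (fun x : ℤ => fun i : Fin 2 => Complex.exp (((ξ * x : ℝ) : ℂ) * Complex.I) * φ x i)
    Filter.atBot (nhds (jvec a0 (-1) ξ))

open Filter Topology

/-- `v` solves the transfer recursion `v(x+1) = T_λ(x) v(x)` on all of `ℤ`. -/
def IsTransferSol (α : ℤ → ℂ) (θ : ℤ → ℝ) (lam : ℂ) (v : ℤ → Fin 2 → ℂ) : Prop :=
  ∀ x : ℤ, v (x + 1) = (Tmat α θ lam x).mulVec (v x)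

lemma rho_pos {a : ℂ} (ha : ‖a‖ < 1) : 0 < rho a :=
  Real.sqrt_pos.2 (by nlinarith [norm_nonneg a])

lemma rho_sq {a : ℂ} (ha : ‖a‖ < 1) : rho a ^ 2 = 1 - ‖a‖ ^ 2 :=
  Real.sq_sqrt (by nlinarith [norm_nonneg a])

lemma det_Tmat {α : ℤ → ℂ} (hα : ∀ x, ‖α x‖ < 1) (θ : ℤ → ℝ) (lam : ℂ) (x : ℤ) :
    (Tmat α θ lam x).det = 1 := by
  have hρ : ((rho (α x) : ℝ) : ℂ) ≠ 0 := by exact_mod_cast (rho_pos (hα x)).ne'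
  have hsq : ((rho (α x) : ℝ) : ℂ) ^ 2 = 1 - α x * (starRingEnd ℂ) (α x) := by
    rw [Complex.mul_conj']
    exact_mod_cast rho_sq (hα x)
  simp only [Tmat, Matrix.det_smul, Matrix.det_fin_two_of, Fintype.card_fin, ← Complex.exp_add,
    add_neg_cancel, Complex.exp_zero, ← hsq]
  field_simp

lemma det2_mulVec (A : Matrix (Fin 2) (Fin 2) ℂ) (v w : Fin 2 → ℂ) :
    det2 (A.mulVec v) (A.mulVec w) = A.det * det2 v w := by
  simp only [det2, Matrix.mulVec, dotProduct, Fin.sum_univ_two, Matrix.det_fin_two]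
  ring

namespace IsTransferSol

variable {α : ℤ → ℂ} {θ : ℤ → ℝ} {lam : ℂ} {v w : ℤ → Fin 2 → ℂ}

lemma det2_eq (hα : ∀ x, ‖α x‖ < 1) (hv : IsTransferSol α θ lam v)
    (hw : IsTransferSol α θ lam w) (x : ℤ) : det2 (v x) (w x) = det2 (v 0) (w 0) := by
  have hper : Function.Periodic (fun x => det2 (v x) (w x)) (1 : ℤ) := fun x => by
    simp only [hv x, hw x, det2_mulVec, det_Tmat hα, one_mul]
  simpa using hper.int_mul_eq x

lemma eq_zero_iff (hα : ∀ x, ‖α x‖ < 1) (hv : IsTransferSol α θ lam v) (x : ℤ) :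
    v x = 0 ↔ v 0 = 0 := by
  have hper : Function.Periodic (fun x => v x = 0) (1 : ℤ) := fun x => by
    refine propext ⟨fun h => ?_, fun h => ?_⟩
    · exact Matrix.eq_zero_of_mulVec_eq_zero (by simp [det_Tmat hα]) ((hv x).symm.trans h)
    · simp only at h ⊢
      rw [hv x, h, Matrix.mulVec_zero]
  simpa using hper.int_mul_eq x

lemma sub_smul (hv : IsTransferSol α θ lam v) (hw : IsTransferSol α θ lam w) (c : ℂ) :
    IsTransferSol α θ lam (fun x => v x - c • w x) := fun x => by
  simp only [hv x, hw x, Matrix.mulVec_sub, Matrix.mulVec_smul]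

end IsTransferSol

lemma exists_eq_smul_of_det2_eq_zero {v w : Fin 2 → ℂ} (hw : w ≠ 0) (h : det2 v w = 0) :
    ∃ c : ℂ, v = c • w := by
  rw [det2, sub_eq_zero] at h
  by_cases h0 : w 0 = 0
  · have h1 : w 1 ≠ 0 := fun h1 => hw (by ext i; fin_cases i <;> simp [h0, h1])
    refine ⟨v 1 / w 1, ?_⟩
    ext i
    fin_cases i
    · simp_all
    · simp [h1]
  · refine ⟨v 0 / w 0, ?_⟩
    ext i
    fin_cases i
    · simp [h0]
    · simp only [Fin.mk_one, Pi.smul_apply, smul_eq_mul]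
      field_simp
      linear_combination -h

lemma det2_eq_zero_trans {u v w : Fin 2 → ℂ} (hu : u ≠ 0) (hv : det2 u v = 0)
    (hw : det2 u w = 0) : det2 v w = 0 := by
  simp only [det2] at *
  by_cases h0 : u 0 = 0
  · have h1 : u 1 ≠ 0 := fun h1 => hu (by ext i; fin_cases i <;> simp [h0, h1])
    refine mul_left_cancel₀ h1 ?_
    linear_combination v 1 * hw - w 1 * hv
  · refine mul_left_cancel₀ h0 ?_
    linear_combination v 0 * hw - w 0 * hv

lemma norm_le_nrm2 (v : Fin 2 → ℂ) : ‖v‖ ≤ nrm2 v := by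
  refine (pi_norm_le_iff_of_nonneg (Real.sqrt_nonneg _)).2 fun i => Real.le_sqrt_of_sq_le ?_
  fin_cases i <;> simp

lemma nrm2_le (v : Fin 2 → ℂ) : nrm2 v ≤ 2 * ‖v‖ := by
  refine Real.sqrt_le_iff.2 ⟨by positivity, ?_⟩
  have h0 := norm_le_pi_norm v 0
  have h1 := norm_le_pi_norm v 1
  nlinarith [norm_nonneg (v 0), norm_nonneg (v 1)]

lemma one_le_jp (x : ℤ) : 1 ≤ jp x := Real.one_le_sqrt.2 (by nlinarith [sq_nonneg (x : ℝ)])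

lemma tendsto_coefficients {α₀ : ℂ} {α : ℤ → ℂ} {θ : ℤ → ℝ}
    (hsum : Summable fun x : ℤ => jp x * (‖α x - α₀‖ + |θ x|)) :
    Tendsto α cofinite (𝓝 α₀) ∧ Tendsto θ cofinite (𝓝 0) := by
  have h := hsum.tendsto_cofinite_zero
  have hle (x : ℤ) : ‖α x - α₀‖ + |θ x| ≤ jp x * (‖α x - α₀‖ + |θ x|) :=
    le_mul_of_one_le_left (by positivity) (one_le_jp x)
  constructor
  · rw [tendsto_iff_norm_sub_tendsto_zero]
    exact squeeze_zero (fun _ => norm_nonneg _)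
      (fun x => (le_add_of_nonneg_right (abs_nonneg _)).trans (hle x)) h
  · exact squeeze_zero_norm
      (fun x => (le_add_of_nonneg_left (norm_nonneg _)).trans (hle x)) h

/-- A bounded sequence whose increments converge has increments tending to zero. -/
lemma eq_zero_of_tendsto_increment_nat {f : ℕ → ℂ} {c : ℂ} {M : ℝ} (hf : ∀ n, ‖f n‖ ≤ M)
    (h : Tendsto (fun n => f (n + 1) - f n) atTop (𝓝 c)) : c = 0 := by
  have hc := h.cesaro_smul
  simp only [Finset.sum_range_sub] at hc
  refine tendsto_nhds_unique hc ?_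
  refine squeeze_zero_norm (a := fun n : ℕ => (n : ℝ)⁻¹ * (2 * M)) (fun n => ?_) ?_
  · rw [norm_smul, norm_inv, RCLike.norm_natCast]
    gcongr
    linarith [norm_sub_le (f n) (f 0), hf n, hf 0]
  · simpa using (tendsto_inv_atTop_nhds_zero_nat (𝕜 := ℝ)).mul_const (2 * M)

lemma eq_zero_of_tendsto_increment {f : ℤ → ℂ} {c : ℂ} {M : ℝ} (hf : ∀ x, ‖f x‖ ≤ M)
    {l : Filter ℤ} (hl : l = atTop ∨ l = atBot)
    (h : Tendsto (fun x => f (x + 1) - f x) l (𝓝 c)) : c = 0 := by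
  rcases hl with rfl | rfl
  · exact eq_zero_of_tendsto_increment_nat (f := fun n : ℕ => f n) (fun n => hf n)
      (by simpa [Function.comp_def] using h.comp tendsto_natCast_atTop_atTop)
  · refine neg_eq_zero.1 (eq_zero_of_tendsto_increment_nat (f := fun n : ℕ => f (-n))
      (fun n => hf _) ?_)
    have ht : Tendsto (fun n : ℕ => -((n : ℤ) + 1)) atTop atBot :=
      tendsto_neg_atTop_atBot.comp (tendsto_atTop_add_const_right _ _ tendsto_natCast_atTop_atTop)
    refine (h.comp ht).neg.congr fun n => ?_
    simp

section Edge

variable {α₀ : ℂ} {ξ : ℝ}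

lemma cos_edge_mul_self (hξ : ξ = 0 ∨ ξ = Real.pi) : Real.cos ξ * Real.cos ξ = 1 := by
  rcases hξ with rfl | rfl <;> simp

lemma exp_edge (hξ : ξ = 0 ∨ ξ = Real.pi) : Complex.exp (ξ * Complex.I) = (Real.cos ξ : ℂ) := by
  rcases hξ with rfl | rfl <;> simp

lemma exp_neg_edge (hξ : ξ = 0 ∨ ξ = Real.pi) :
    Complex.exp (-(ξ * Complex.I)) = (Real.cos ξ : ℂ) := by
  rcases hξ with rfl | rfl <;> simp [Complex.exp_neg]

lemma exp_edge_mul_int (hξ : ξ = 0 ∨ ξ = Real.pi) (x : ℤ) :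
    Complex.exp (((ξ * x : ℝ) : ℂ) * Complex.I) = (Real.cos ξ : ℂ) ^ x := by
  rw [← exp_edge hξ, ← Complex.exp_int_mul]
  congr 1
  push_cast
  ring

lemma exp_neg_edge_mul_int (hξ : ξ = 0 ∨ ξ = Real.pi) (x : ℤ) :
    Complex.exp (-(((ξ * x : ℝ) : ℂ) * Complex.I)) = (Real.cos ξ : ℂ) ^ x := by
  rw [← exp_neg_edge hξ, ← Complex.exp_int_mul]
  congr 1
  push_cast
  ring

lemma norm_cos_edge_zpow (hξ : ξ = 0 ∨ ξ = Real.pi) (x : ℤ) : ‖(Real.cos ξ : ℂ) ^ x‖ = 1 := by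
  rw [← exp_edge_mul_int hξ, Complex.norm_exp_ofReal_mul_I]

lemma exp_lamOf_edge (h₁ : ‖α₀‖ < 1) (hξ : ξ = 0 ∨ ξ = Real.pi) :
    Complex.exp (Complex.I * (lamOf α₀ ξ : ℂ)) =
      (rho α₀ : ℂ) * (Real.cos ξ : ℂ) + Complex.I * (‖α₀‖ : ℂ) := by
  have hsq : (rho α₀ * Real.cos ξ) ^ 2 = 1 - ‖α₀‖ ^ 2 := by
    rw [mul_pow, rho_sq h₁, sq (Real.cos ξ), cos_edge_mul_self hξ, mul_one]
  have habs : |rho α₀ * Real.cos ξ| ≤ 1 :=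
    abs_le_one_iff_mul_self_le_one.2 (by nlinarith [sq_nonneg ‖α₀‖])
  rw [mul_comm, Complex.exp_mul_I, ← Complex.ofReal_cos, ← Complex.ofReal_sin, lamOf,
    Real.cos_arccos (neg_le_of_abs_le habs) (le_of_abs_le habs), Real.sin_arccos, hsq,
    sub_sub_cancel, Real.sqrt_sq (norm_nonneg _)]
  push_cast
  ring

lemma Aco_pos (h₀ : 0 < ‖α₀‖) (ε ξ : ℝ) : 0 < Aco α₀ ε ξ := by
  unfold Aco
  positivity

lemma jvec_ne_zero (h₀ : 0 < ‖α₀‖) (ε ξ : ℝ) : jvec α₀ ε ξ ≠ 0 := fun h => by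
  have h' := congrFun h 0
  have := (Real.sqrt_pos.2 (Aco_pos h₀ ε ξ)).ne'
  simp [jvec, this, norm_pos_iff.1 h₀] at h'

lemma jvec_edge (h₁ : ‖α₀‖ < 1) (hξ : ξ = 0 ∨ ξ = Real.pi) {ε : ℝ} (hε : ε = 1 ∨ ε = -1) :
    jvec α₀ ε ξ = (((Real.sqrt (Aco α₀ ε ξ))⁻¹ : ℝ) : ℂ) • ![-α₀, Complex.I * (‖α₀‖ : ℂ)] := by
  have h : Complex.exp (((ε * ξ : ℝ) : ℂ) * Complex.I) = (Real.cos ξ : ℂ) := by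
    rcases hε with rfl | rfl
    · rw [one_mul, exp_edge hξ]
    · rw [← exp_neg_edge hξ]
      congr 1
      push_cast
      ring
  rw [jvec, h, exp_lamOf_edge h₁ hξ, add_sub_cancel_left]

/-- At the edge, a bounded solution is proportional to any solution asymptotic (up to the edge
phase) to the unit eigenvector. -/
lemma IsTransferSol.det2_eq_zero_of_bounded (h₀ : 0 < ‖α₀‖) (h₁ : ‖α₀‖ < 1)
    {α : ℤ → ℂ} {θ : ℤ → ℝ} (hα : ∀ x : ℤ, ‖α x‖ < 1) {l : Filter ℤ}
    (hl : l = atTop ∨ l = atBot) (hαl : Tendsto α l (𝓝 α₀)) (hθl : Tendsto θ l (𝓝 0))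
    (hξ : ξ = 0 ∨ ξ = Real.pi) {ε : ℝ} (hε : ε = 1 ∨ ε = -1) {v φ : ℤ → Fin 2 → ℂ}
    (hv : IsTransferSol α θ (lamOf α₀ ξ : ℝ) v) (hφ : IsTransferSol α θ (lamOf α₀ ξ : ℝ) φ)
    {M : ℝ} (hM : ∀ x, ‖v x‖ ≤ M)
    (hlim : Tendsto (fun x => (Real.cos ξ : ℂ) ^ x • φ x) l (𝓝 (jvec α₀ ε ξ))) :
    det2 (v 0) (φ 0) = 0 := by
  set σ : ℂ := (Real.cos ξ : ℂ) with hσ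
  have hσσ : σ * σ = 1 := by rw [hσ]; exact_mod_cast cos_edge_mul_self hξ
  have hσ0 : σ ≠ 0 := left_ne_zero_of_mul_eq_one hσσ
  have hσx (x : ℤ) : σ ^ x * σ ^ x = 1 := by rw [← mul_zpow, hσσ, _root_.one_zpow]
  have hρ0 : (rho α₀ : ℂ) ≠ 0 := by exact_mod_cast (rho_pos h₁).ne'
  set e := jvec α₀ ε ξ with he
  set c : ℂ := (((Real.sqrt (Aco α₀ ε ξ))⁻¹ : ℝ) : ℂ) with hc
  have hc0 : c ≠ 0 := by
    rw [hc]; exact_mod_cast inv_ne_zero (Real.sqrt_pos.2 (Aco_pos h₀ ε ξ)).ne'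
  have he0 : e 0 = c * -α₀ := by simp [he, jvec_edge h₁ hξ hε, hc]
  have he1 : e 1 = c * (Complex.I * ‖α₀‖) := by simp [he, jvec_edge h₁ hξ hε, hc]
  set w : ℤ → Fin 2 → ℂ := fun x => σ ^ x • v x with hw
  have hwM (i : Fin 2) (x : ℤ) : ‖w x i‖ ≤ M := by
    simp only [hw]
    rw [Pi.smul_apply, norm_smul, norm_cos_edge_zpow hξ, one_mul]
    exact (norm_le_pi_norm _ _).trans (hM x)
  have hsmall {a : ℤ → ℂ} {a₀ : ℂ} (ha : Tendsto a l (𝓝 a₀)) (i : Fin 2) :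
      Tendsto (fun x => (a x - a₀) * w x i) l (𝓝 0) := by
    refine squeeze_zero_norm (a := fun x => ‖a x - a₀‖ * M) (fun x => ?_) ?_
    · rw [norm_mul]
      gcongr
      exact hwM i x
    · simpa using (tendsto_iff_norm_sub_tendsto_zero.1 ha).mul_const M
  have hcomp (i : Fin 2) : Tendsto (fun x => σ ^ x * φ x i) l (𝓝 (e i)) := by
    simpa using tendsto_pi_nhds.1 hlim i
  set W := det2 (v 0) (φ 0) with hW
  have hdet : Tendsto (fun x => det2 (w x) e) l (𝓝 W) := by
    have h := ((hsmall (hcomp 0) 1).sub (hsmall (hcomp 1) 0)).add_const W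
    rw [sub_zero, zero_add] at h
    refine h.congr fun x => ?_
    have hWx : W = v x 0 * φ x 1 - v x 1 * φ x 0 := (hv.det2_eq hα hφ x).symm
    simp only [hw, det2, Pi.smul_apply, smul_eq_mul]
    linear_combination hWx - (v x 0 * φ x 1 - v x 1 * φ x 0) * hσx x
  have hρl : Tendsto (fun x => σ * (rho (α x) : ℂ)⁻¹) l (𝓝 (σ * (rho α₀ : ℂ)⁻¹)) := by
    have hr : Continuous rho := by unfold rho; fun_prop
    exact (((Complex.continuous_ofReal.tendsto _).comp
      ((hr.tendsto _).comp hαl)).inv₀ hρ0).const_mul σ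
  have hEl : Tendsto (fun x => Complex.exp (Complex.I * ((lamOf α₀ ξ : ℝ) - (θ x : ℂ)))) l
      (𝓝 (Complex.exp (Complex.I * (lamOf α₀ ξ : ℝ)))) := by
    have hcont : Continuous fun t : ℝ =>
      Complex.exp (Complex.I * ((lamOf α₀ ξ : ℝ) - (t : ℂ))) := by fun_prop
    simpa [Function.comp_def] using (hcont.tendsto 0).comp hθl
  have hlin := ((hsmall (hρl.mul hEl) 0).add (hsmall (hρl.mul hαl) 1)).add
    (hdet.const_mul (σ * (rho α₀ : ℂ)⁻¹ * c⁻¹))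
  rw [add_zero, zero_add] at hlin
  have hinc : Tendsto (fun x => w (x + 1) 0 - w x 0) l
      (𝓝 (σ * (rho α₀ : ℂ)⁻¹ * c⁻¹ * W)) := by
    refine hlin.congr fun x => ?_
    have hstep : w (x + 1) 0 = σ * (rho (α x) : ℂ)⁻¹ *
        (Complex.exp (Complex.I * ((lamOf α₀ ξ : ℝ) - (θ x : ℂ))) * w x 0 + α x * w x 1) := by
      simp only [hw, hv x, Tmat, Pi.smul_apply, smul_eq_mul, zpow_add_one₀ hσ0,
        Matrix.smul_apply, Matrix.mulVec, dotProduct, Fin.sum_univ_two, Matrix.of_apply,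
        Matrix.cons_val', Matrix.cons_val_zero, Matrix.cons_val_one, Matrix.cons_val_fin_one]
      ring
    rw [hstep, exp_lamOf_edge h₁ hξ, det2, he0, he1, ← hσ]
    field_simp
    linear_combination (-(rho α₀ : ℂ) * w x 0) * hσσ
  have hzero := eq_zero_of_tendsto_increment (hwM 0) hl hinc
  simpa [hσ0, hρ0, hc0] using hzero

end Edge

/-- at the edge (`ξ = 0` or `ξ = π`), the Wronskian of the Jost solutions
vanishes iff there is a nonzero bounded solution of the transfer recursion. -/
theorem stmt17 (α₀ : ℂ) (h₀ : 0 < ‖α₀‖) (h₁ : ‖α₀‖ < 1)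
    (α : ℤ → ℂ) (θ : ℤ → ℝ) (hα : ∀ x : ℤ, ‖α x‖ < 1)
    (hsum : Summable fun x : ℤ => jp x * (‖α x - α₀‖ + |θ x|))
    (ξ : ℝ) (hξ : ξ = 0 ∨ ξ = Real.pi)
    (φp φm : ℤ → Fin 2 → ℂ)
    (hp : IsJostP α θ α₀ ξ φp) (hm : IsJostM α θ α₀ ξ φm) :
    det2 (φp 0) (φm 0) = 0 ↔
      ∃ v : ℤ → Fin 2 → ℂ, (∃ x : ℤ, v x ≠ 0) ∧ (∃ M : ℝ, ∀ x : ℤ, nrm2 (v x) ≤ M) ∧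
        ∀ x : ℤ, v (x + 1) = (Tmat α θ ((lamOf α₀ ξ : ℝ) : ℂ) x).mulVec (v x) := by
  obtain ⟨hαl, hθl⟩ := tendsto_coefficients hsum
  rw [Int.cofinite_eq, tendsto_sup] at hαl hθl
  have hsolp : IsTransferSol α θ (lamOf α₀ ξ : ℝ) φp := hp.1
  have hsolm : IsTransferSol α θ (lamOf α₀ ξ : ℝ) φm := hm.1
  have hlimp : Tendsto (fun x => (Real.cos ξ : ℂ) ^ x • φp x) atTop (𝓝 (jvec α₀ 1 ξ)) :=
    hp.2.congr fun x => by ext i; simp only [exp_neg_edge_mul_int hξ, Pi.smul_apply, smul_eq_mul]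
  have hlimm : Tendsto (fun x => (Real.cos ξ : ℂ) ^ x • φm x) atBot (𝓝 (jvec α₀ (-1) ξ)) :=
    hm.2.congr fun x => by ext i; simp only [exp_edge_mul_int hξ, Pi.smul_apply, smul_eq_mul]
  have hnormp : Tendsto (fun x => ‖φp x‖) atTop (𝓝 ‖jvec α₀ 1 ξ‖) :=
    hlimp.norm.congr fun x => by rw [norm_smul, norm_cos_edge_zpow hξ, one_mul]
  have hnormm : Tendsto (fun x => ‖φm x‖) atBot (𝓝 ‖jvec α₀ (-1) ξ‖) :=
    hlimm.norm.congr fun x => by rw [norm_smul, norm_cos_edge_zpow hξ, one_mul]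
  have hp0 : φp 0 ≠ 0 := fun h => by
    have hzero : Tendsto (fun x => ‖φp x‖) atTop (𝓝 0) :=
      tendsto_const_nhds.congr fun x => by rw [(hsolp.eq_zero_iff hα x).2 h, norm_zero]
    exact jvec_ne_zero h₀ 1 ξ (norm_eq_zero.1 (tendsto_nhds_unique hnormp hzero))
  have hm0 : φm 0 ≠ 0 := fun h => by
    have hzero : Tendsto (fun x => ‖φm x‖) atBot (𝓝 0) :=
      tendsto_const_nhds.congr fun x => by rw [(hsolm.eq_zero_iff hα x).2 h, norm_zero]
    exact jvec_ne_zero h₀ (-1) ξ (norm_eq_zero.1 (tendsto_nhds_unique hnormm hzero))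
  constructor
  · intro hW
    obtain ⟨c, hc⟩ := exists_eq_smul_of_det2_eq_zero hm0 hW
    have hprop (x : ℤ) : φp x = c • φm x := by
      have h := ((hsolp.sub_smul hsolm c).eq_zero_iff hα x).2 (sub_eq_zero.2 hc)
      exact sub_eq_zero.1 h
    have hnormp' : Tendsto (fun x => ‖φp x‖) atBot (𝓝 (‖c‖ * ‖jvec α₀ (-1) ξ‖)) :=
      (hnormm.const_mul ‖c‖).congr fun x => by rw [hprop, norm_smul]
    have hbdd : IsBoundedUnder (· ≤ ·) cofinite fun x => ‖φp x‖ := by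
      rw [Int.cofinite_eq, IsBoundedUnder, Filter.map_sup]
      exact isBounded_sup hnormp'.isBoundedUnder_le hnormp.isBoundedUnder_le
    obtain ⟨M, hM⟩ := hbdd.bddAbove_range_of_cofinite
    refine ⟨φp, ⟨0, hp0⟩, ⟨2 * M, fun x => (nrm2_le _).trans ?_⟩, hp.1⟩
    linarith [hM (Set.mem_range_self x)]
  · rintro ⟨v, ⟨x, hx⟩, ⟨M, hM⟩, hv⟩
    have hsolv : IsTransferSol α θ (lamOf α₀ ξ : ℝ) v := hv
    have hv0 : v 0 ≠ 0 := fun h => hx ((hsolv.eq_zero_iff hα x).2 h)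
    have hM' (x : ℤ) : ‖v x‖ ≤ M := (norm_le_nrm2 _).trans (hM x)
    exact det2_eq_zero_trans hv0
      (hsolv.det2_eq_zero_of_bounded h₀ h₁ hα (.inl rfl) hαl.2 hθl.2 hξ (.inl rfl) hsolp hM' hlimp)
      (hsolv.det2_eq_zero_of_bounded h₀ h₁ hα (.inr rfl) hαl.1 hθl.1 hξ (.inr rfl) hsolm hM' hlimm)
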